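/- Fix an integer k ≥ 2 and let β ∈ ℕ with β ≥ k−1. Let P₁, …, P_k be polynomials with P_i ∈ 𝒫_{β+r_i} for 1 ≤ i ≤ k, set P_{k+1} = 0, and suppose that every P_i vanishes upon substituting ε = 0. If for every choice of polynomials Q₁, …, Q_{k+1} with Q_i ∈ 𝒫_{β−(k−1)+r_i} one has Σ_{i=1}^{k} ⟨[F,Q]_i, P_i⟩_{r,β+r_i} = 0, where [F,Q]_i = Σⱼ (Fⱼ ∂Q_i/∂xⱼ − Qⱼ ∂F_i/∂xⱼ), then P_i = 0 for every 1 ≤ i ≤ k. (This is the quasidegree-β statement underlying the formal normal form theorem: the only resonant good perturbation of F is zero, so every good perturbation X = F + P of F is formally conjugate to F.) -/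

import Mathlib

open MvPolynomial

noncomputable section

/-- The weight vector `r`: variable `xᵢ` (1-based `i ≤ k`, 0-based index `i-1`) has weight
`k+1-i`, so on 0-based index `j < k` the weight is `k - j`; `z` is the variable of 0-based
index `k-1` (weight `1`) and `ε` is the variable of 0-based index `k` (weight `2k-1`). -/
def w (k : ℕ) (i : Fin (k + 1)) : ℕ := if (i : ℕ) < k then k - (i : ℕ) else 2 * k - 1

/-- The index of the variable `z = x_k`. -/
def zv (k : ℕ) : Fin (k + 1) := ⟨k - 1, by omega⟩

/-- The index of the variable `ε = x_{k+1}`. -/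
def ev (k : ℕ) : Fin (k + 1) := ⟨k, by omega⟩

/-- Membership in `𝒫_δ`: every monomial of `f` has weighted degree `δ`. -/
def IsQH (k δ : ℕ) (f : MvPolynomial (Fin (k + 1)) ℝ) : Prop :=
  ∀ s ∈ f.support, ∑ i, w k i * s i = δ

/-- `G_k = z^k + Σ_{i=1}^{k-1} x_i z^{i-1}` (0-based: `Σ_{j<k-1} x_j z^j`). -/
def G (k : ℕ) : MvPolynomial (Fin (k + 1)) ℝ :=
  (X (zv k)) ^ k
    + ∑ i : Fin (k + 1), if (i : ℕ) < k - 1 then X i * (X (zv k)) ^ (i : ℕ) else 0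

/-- The inner product `⟨f,g⟩_{r,δ} = Σ_{(r,s)=δ} f_s g_s (s!)^r / δ!`. -/
def ip (k δ : ℕ) (f g : MvPolynomial (Fin (k + 1)) ℝ) : ℝ :=
  ∑ s ∈ f.support ∪ g.support,
    f.coeff s * g.coeff s * ((∏ i, ((s i).factorial : ℝ) ^ w k i) / (δ.factorial : ℝ))

/-- The principal part `F`: `F₁ = ε`, `Fᵢ = 0` for `2 ≤ i ≤ k-1`, `F_k = -G_k`, `F_{k+1} = 0`. -/
def Fv (k : ℕ) : Fin (k + 1) → MvPolynomial (Fin (k + 1)) ℝ :=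
  fun i => if (i : ℕ) = 0 then X (ev k) else if i = zv k then -(G k) else 0

/-- Components of the Lie bracket `[F,Q]ᵢ = Σⱼ (Fⱼ ∂Qᵢ/∂xⱼ − Qⱼ ∂Fᵢ/∂xⱼ)`. -/
def brkt (k : ℕ) (Q : Fin (k + 1) → MvPolynomial (Fin (k + 1)) ℝ) (i : Fin (k + 1)) :
    MvPolynomial (Fin (k + 1)) ℝ :=
  ∑ j, (Fv k j * pderiv j (Q i) - Q j * pderiv j (Fv k i))

theorem w_zero {k : ℕ} (hk : 0 < k) : w k 0 = k := by
  simp [w, hk]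

theorem w_ev (k : ℕ) : w k (ev k) = 2 * k - 1 := by
  simp [w, ev]

theorem w_zv {k : ℕ} (hk : 0 < k) : w k (zv k) = 1 := by
  have h : (zv k : ℕ) < k := Nat.sub_lt hk one_pos
  rw [w, if_pos h]
  exact Nat.sub_sub_self hk

theorem isQH_zero (k δ : ℕ) : IsQH k δ 0 := by
  simp [IsQH]

theorem isQH_pi_single {k : ℕ} {δ : Fin (k + 1) → ℕ} {m : Fin (k + 1)}
    {q : MvPolynomial (Fin (k + 1)) ℝ} (hq : IsQH k (δ m) q) (i : Fin (k + 1)) :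
    IsQH k (δ i) ((Pi.single m q : Fin (k + 1) → MvPolynomial (Fin (k + 1)) ℝ) i) := by
  by_cases h : i = m
  · subst h
    simpa using hq
  · simpa [Pi.single_eq_of_ne h] using isQH_zero k (δ i)

theorem ip_zero_left (k δ : ℕ) (g : MvPolynomial (Fin (k + 1)) ℝ) : ip k δ 0 g = 0 := by
  simp [ip]

theorem ip_zero_right (k δ : ℕ) (f : MvPolynomial (Fin (k + 1)) ℝ) : ip k δ f 0 = 0 := by
  simp [ip]

theorem ip_neg_left (k δ : ℕ) (f g : MvPolynomial (Fin (k + 1)) ℝ) :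
    ip k δ (-f) g = -ip k δ f g := by
  simp [ip]

theorem ip_weight_pos (k δ : ℕ) (s : Fin (k + 1) →₀ ℕ) :
    0 < (∏ i, ((s i).factorial : ℝ) ^ w k i) / (δ.factorial : ℝ) := by
  positivity

theorem eq_zero_of_ip_self_eq_zero {k δ : ℕ} {f : MvPolynomial (Fin (k + 1)) ℝ}
    (h : ip k δ f f = 0) : f = 0 := by
  rw [ip, Finset.sum_eq_zero_iff_of_nonneg fun s _ =>
    mul_nonneg (mul_self_nonneg _) (ip_weight_pos k δ s).le] at h
  ext s
  by_contra hs
  have hmem : s ∈ f.support ∪ f.support := by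
    simpa using hs
  rcases mul_eq_zero.mp (h s hmem) with h' | h'
  · exact hs (by simpa using h')
  · exact (ip_weight_pos k δ s).ne' h'

/-- If `f` and `g` have at most the monomial `s` in common and are orthogonal, then `s` occurs in
at most one of them. -/
theorem coeff_mul_coeff_eq_zero_of_ip {k δ : ℕ} {f g : MvPolynomial (Fin (k + 1)) ℝ}
    {s : Fin (k + 1) →₀ ℕ} (hfg : ∀ t, t ≠ s → f.coeff t * g.coeff t = 0)
    (h : ip k δ f g = 0) : f.coeff s * g.coeff s = 0 := by
  rw [ip, Finset.sum_eq_single s (fun t _ ht => by rw [hfg t ht, zero_mul])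
    (fun hs => by
      rw [Finset.mem_union, not_or, notMem_support_iff] at hs
      rw [hs.1, zero_mul, zero_mul])] at h
  exact (mul_eq_zero.mp h).resolve_right (ip_weight_pos k δ s).ne'

theorem Fv_zero (k : ℕ) : Fv k 0 = X (ev k) := by
  simp [Fv]

theorem Fv_zv {k : ℕ} (hk : 2 ≤ k) : Fv k (zv k) = -G k := by
  have h : k - 1 ≠ 0 := by omega
  simp [Fv, zv, h]

theorem Fv_of_ne {k : ℕ} {i : Fin (k + 1)} (h0 : i ≠ 0) (hz : i ≠ zv k) : Fv k i = 0 := by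
  have h : (i : ℕ) ≠ 0 := fun h => h0 (Fin.ext h)
  simp [Fv, h, hz]

theorem zero_ne_zv {k : ℕ} (hk : 2 ≤ k) : (0 : Fin (k + 1)) ≠ zv k := by
  simp only [zv, ne_eq, Fin.ext_iff, Fin.val_zero]
  omega

theorem zero_ne_ev {k : ℕ} (hk : 0 < k) : (0 : Fin (k + 1)) ≠ ev k := by
  simp only [ev, ne_eq, Fin.ext_iff, Fin.val_zero]
  omega

theorem zv_ne_ev {k : ℕ} (hk : 0 < k) : zv k ≠ ev k := by
  simp only [zv, ev, ne_eq, Fin.ext_iff]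
  omega

theorem ne_ev_of_lt {k : ℕ} {i : Fin (k + 1)} (hi : (i : ℕ) < k) : i ≠ ev k := by
  rintro rfl
  exact lt_irrefl _ hi

theorem sum_Fv_mul_pderiv {k : ℕ} (hk : 2 ≤ k) (q : MvPolynomial (Fin (k + 1)) ℝ) :
    ∑ j, Fv k j * pderiv j q = X (ev k) * pderiv 0 q - G k * pderiv (zv k) q := by
  rw [Fintype.sum_eq_add 0 (zv k) (zero_ne_zv hk)
    fun j hj => by rw [Fv_of_ne hj.1 hj.2, zero_mul], Fv_zero, Fv_zv hk]
  ring

theorem brkt_single_self {k : ℕ} (m : Fin (k + 1)) (q : MvPolynomial (Fin (k + 1)) ℝ) :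
    brkt k (Pi.single m q) m = ∑ j, Fv k j * pderiv j q - q * pderiv m (Fv k m) := by
  rw [brkt, Finset.sum_sub_distrib]
  congr 1
  · simp
  · rw [Fintype.sum_eq_single m fun j hj => by rw [Pi.single_eq_of_ne hj, zero_mul]]
    simp

theorem brkt_single_of_ne {k : ℕ} {m i : Fin (k + 1)} (h : i ≠ m)
    (q : MvPolynomial (Fin (k + 1)) ℝ) :
    brkt k (Pi.single m q) i = -(q * pderiv m (Fv k i)) := by
  rw [brkt, Fintype.sum_eq_single m fun j hj => by
    rw [Pi.single_eq_of_ne hj, Pi.single_eq_of_ne h, map_zero]; ring]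
  simp [Pi.single_eq_of_ne h]

theorem isWeightedHomogeneous_G {k : ℕ} (hk : 0 < k) :
    IsWeightedHomogeneous (Pi.single (ev k) 1 : Fin (k + 1) → ℕ) (G k) 0 := by
  have hX : ∀ i : Fin (k + 1), i ≠ ev k →
      IsWeightedHomogeneous (Pi.single (ev k) 1 : Fin (k + 1) → ℕ) (X i : MvPolynomial _ ℝ) 0 := by
    intro i hi
    simpa [Pi.single_eq_of_ne hi] using
      isWeightedHomogeneous_X ℝ (Pi.single (ev k) 1 : Fin (k + 1) → ℕ) i
  have hz := hX (zv k) (zv_ne_ev hk)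
  refine IsWeightedHomogeneous.add (by simpa using hz.pow k) ?_
  refine IsWeightedHomogeneous.sum _ _ _ fun i _ => ?_
  split_ifs with hi
  · simpa using (hX i (ne_ev_of_lt (by omega))).mul (hz.pow i)
  · exact isWeightedHomogeneous_zero _ _ _

theorem weight_single_one {σ : Type*} [DecidableEq σ] (i : σ) (s : σ →₀ ℕ) :
    Finsupp.weight (Pi.single i 1 : σ → ℕ) s = s i := by
  rw [Finsupp.weight_apply, Finsupp.sum, Finset.sum_eq_single i]
  · simp
  · intro j _ hj
    simp [Pi.single_eq_of_ne hj]
  · intro hi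
    simp [Finsupp.notMem_support_iff.mp hi]

theorem coeff_G_mul_pderiv_monomial {k : ℕ} (hk : 0 < k) {v t : Fin (k + 1) →₀ ℕ}
    (h : t (ev k) ≠ v (ev k)) :
    coeff t (G k * pderiv (zv k) (monomial v (1 : ℝ))) = 0 := by
  rw [pderiv_monomial]
  have hG := (isWeightedHomogeneous_G hk).mul
    (isWeightedHomogeneous_monomial (Pi.single (ev k) 1 : Fin (k + 1) → ℕ)
      (v - Finsupp.single (zv k) 1) (1 * (v (zv k) : ℝ)) rfl)
  refine hG.coeff_eq_zero t ?_
  rw [weight_single_one, weight_single_one]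
  simpa [Finsupp.single_eq_of_ne (zv_ne_ev hk).symm] using h

theorem coeff_aeval_erase {σ R : Type*} [DecidableEq σ] [CommSemiring R] (e : σ) {t : σ →₀ ℕ}
    (ht : t e = 0) (p : MvPolynomial σ R) :
    coeff t (aeval (fun j => if j = e then 0 else X j) p : MvPolynomial σ R) = coeff t p := by
  induction p using MvPolynomial.induction_on' with
  | monomial s a =>
    rw [aeval_monomial]
    by_cases hs : s e = 0
    · rw [monomial_eq, algebraMap_eq]
      congr 2
      refine Finsupp.prod_congr fun j hj => ?_
      rw [if_neg]
      rintro rfl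
      exact (Finsupp.mem_support_iff.mp hj) hs
    · rw [coeff_monomial, if_neg (by rintro rfl; exact hs ht), Finsupp.prod,
        Finset.prod_eq_zero (Finsupp.mem_support_iff.mpr hs) (by simp [hs]), mul_zero, coeff_zero]
  | add p q hp hq => rw [map_add, coeff_add, coeff_add, hp, hq]

theorem isQH_monomial {k δ : ℕ} {s : Fin (k + 1) →₀ ℕ} (hs : ∑ i, w k i * s i = δ) (c : ℝ) :
    IsQH k δ (monomial s c) := by
  intro t ht
  rw [Finset.mem_singleton.mp (support_monomial_subset ht), hs]

theorem sum_w_mul_add_single (k : ℕ) (u : Fin (k + 1) →₀ ℕ) (j : Fin (k + 1)) :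
    ∑ i, w k i * (u + Finsupp.single j 1 : Fin (k + 1) →₀ ℕ) i = ∑ i, w k i * u i + w k j := by
  simp [mul_add, Finset.sum_add_distrib, Finsupp.single_apply]

/-- A quasihomogeneous polynomial that is divisible by `ε` and orthogonal to the image of the
derivation `F` vanishes. -/
theorem eq_zero_of_ip_derivation_eq_zero {k δ : ℕ} (hk : 2 ≤ k)
    {p : MvPolynomial (Fin (k + 1)) ℝ} (hp : IsQH k (δ + (k - 1)) p)
    (hp0 : ∀ s, s (ev k) = 0 → coeff s p = 0)
    (horth : ∀ q, IsQH k δ q → ip k (δ + (k - 1)) (∑ j, Fv k j * pderiv j q) p = 0) :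
    p = 0 := by
  have key : ∀ a : ℕ, ∀ s : Fin (k + 1) →₀ ℕ, s (ev k) = a → coeff s p = 0 := by
    intro a
    induction a with
    | zero => exact hp0
    | succ a ih =>
      intro s hs
      by_contra hne
      obtain ⟨u, rfl⟩ : ∃ u, s = u + Finsupp.single (ev k) 1 :=
        ⟨s - Finsupp.single (ev k) 1, (tsub_add_cancel_of_le
          (Finsupp.single_le_iff.mpr (by omega))).symm⟩
      have hu : u (ev k) = a := by simpa using hs
      set v := u + Finsupp.single 0 1 with hv
      have hve : v (ev k) = a := by
        simp [hv, hu, Finsupp.single_eq_of_ne (zero_ne_ev (k := k) (by omega)).symm]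
      have hdeg := hp _ (mem_support_iff.mpr hne)
      rw [sum_w_mul_add_single, w_ev] at hdeg
      have hq : IsQH k δ (monomial v (1 : ℝ)) := by
        refine isQH_monomial ?_ 1
        rw [hv, sum_w_mul_add_single, w_zero (by omega)]
        omega
      have hD := horth _ hq
      have hX : X (ev k) * pderiv 0 (monomial v (1 : ℝ))
          = monomial (u + Finsupp.single (ev k) 1) ((u 0 : ℝ) + 1) := by
        rw [pderiv_monomial, hv, add_tsub_cancel_right, X, monomial_mul,
          add_comm (Finsupp.single (ev k) 1) u]
        simp
      rw [sum_Fv_mul_pderiv hk, hX] at hD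
      have hprod := coeff_mul_coeff_eq_zero_of_ip (s := u + Finsupp.single (ev k) 1) (fun t ht => by
        by_cases hta : t (ev k) = a
        · rw [ih t hta, mul_zero]
        · rw [coeff_sub, coeff_monomial, if_neg ht.symm,
            coeff_G_mul_pderiv_monomial (by omega) (by rwa [hve]), sub_zero, zero_mul]) hD
      rw [coeff_sub, coeff_monomial, if_pos rfl,
        coeff_G_mul_pderiv_monomial (by omega) (by rw [hve, hs]; omega), sub_zero] at hprod
      exact hne ((mul_eq_zero.mp hprod).resolve_left (by positivity))
  ext s
  simpa using key _ s rfl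

theorem pderiv_ev_G {k : ℕ} (hk : 0 < k) : pderiv (ev k) (G k) = 0 := by
  have hz : pderiv (ev k) (X (zv k) : MvPolynomial (Fin (k + 1)) ℝ) = 0 :=
    pderiv_X_of_ne (zv_ne_ev hk)
  rw [G, map_add, map_sum, pderiv_pow, hz, mul_zero, zero_add]
  refine Finset.sum_eq_zero fun i _ => ?_
  split_ifs with hi
  · have hi' : i ≠ ev k := ne_ev_of_lt (by omega)
    rw [pderiv_mul, pderiv_pow, hz, pderiv_X_of_ne hi']
    simp
  · exact map_zero _

theorem pderiv_zero_G {k : ℕ} (hk : 2 ≤ k) : pderiv 0 (G k) = 1 := by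
  have hz : pderiv 0 (X (zv k) : MvPolynomial (Fin (k + 1)) ℝ) = 0 :=
    pderiv_X_of_ne (zero_ne_zv hk).symm
  rw [G, map_add, map_sum, pderiv_pow, hz, mul_zero, zero_add,
    Fintype.sum_eq_single 0 fun i hi => ?_]
  · rw [if_pos (by simp only [Fin.val_zero]; omega)]
    simp
  · split_ifs
    · rw [pderiv_mul, pderiv_pow, hz, pderiv_X_of_ne hi]
      simp
    · exact map_zero _

/-- if `P = (P₁,…,P_k,0)` with `Pᵢ ∈ 𝒫_{β+rᵢ}`, each `Pᵢ` vanishing upon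
substituting `ε = 0`, and `P` is orthogonal to `[F,Q]` for all `Q` with
`Qᵢ ∈ 𝒫_{β-(k-1)+rᵢ}` (i.e. `P` lies in the kernel of the adjoint `d*` of the homological
operator `d(Q) = [F,Q]`, i.e. `P` is resonant), then `P = 0`. -/
theorem resonant_good_perturbation_is_zero (k : ℕ) (hk : 2 ≤ k) (β : ℕ) (hβ : k - 1 ≤ β)
    (P : Fin (k + 1) → MvPolynomial (Fin (k + 1)) ℝ)
    (hP : ∀ i : Fin (k + 1), (i : ℕ) < k → IsQH k (β + w k i) (P i))
    (hPe : P (ev k) = 0)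
    (hP0 : ∀ i : Fin (k + 1),
      aeval (fun j : Fin (k + 1) => if j = ev k then 0 else X j) (P i)
        = (0 : MvPolynomial (Fin (k + 1)) ℝ))
    (horth : ∀ Q : Fin (k + 1) → MvPolynomial (Fin (k + 1)) ℝ,
      (∀ i : Fin (k + 1), IsQH k (β - (k - 1) + w k i) (Q i)) →
      ∑ i ∈ Finset.univ.filter (fun i : Fin (k + 1) => (i : ℕ) < k),
        ip k (β + w k i) (brkt k Q i) (P i) = 0) :
    ∀ i : Fin (k + 1), (i : ℕ) < k → P i = 0 := by
  have hlt : ∀ i, i ∈ Finset.univ.filter (fun i : Fin (k + 1) => (i : ℕ) < k) ↔ (i : ℕ) < k := by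
    simp
  have h0k : ((0 : Fin (k + 1)) : ℕ) < k := by
    simp only [Fin.val_zero]
    omega
  have hzk : (zv k : ℕ) < k := by
    simp only [zv]
    omega
  have hsingle : ∀ m q, IsQH k (β - (k - 1) + w k m) q →
      ∑ i ∈ Finset.univ.filter (fun i : Fin (k + 1) => (i : ℕ) < k),
        ip k (β + w k i) (brkt k (Pi.single m q) i) (P i) = 0 := fun m q hq =>
    horth _ (isQH_pi_single (δ := fun i => β - (k - 1) + w k i) hq)
  have hP_zero : P 0 = 0 := by
    have h := hsingle (ev k) (P 0) (by
      have := hP 0 h0k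
      rw [w_zero (by omega)] at this
      rwa [w_ev, show β - (k - 1) + (2 * k - 1) = β + k by omega])
    rw [Finset.sum_eq_single_of_mem 0 ((hlt 0).mpr h0k) fun i hi hi0 => ?_] at h
    · rw [brkt_single_of_ne (zero_ne_ev (by omega)), Fv_zero, pderiv_X_self, mul_one,
        ip_neg_left, neg_eq_zero] at h
      exact eq_zero_of_ip_self_eq_zero h
    · rw [brkt_single_of_ne (ne_ev_of_lt ((hlt i).mp hi))]
      by_cases hiz : i = zv k
      · rw [hiz, Fv_zv hk, map_neg, pderiv_ev_G (by omega)]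
        simp [ip_zero_left]
      · rw [Fv_of_ne hi0 hiz]
        simp [ip_zero_left]
  have hP_zv : P (zv k) = 0 := by
    have h := hsingle 0 (P (zv k)) (by
      have := hP (zv k) hzk
      rw [w_zv (by omega)] at this
      rwa [w_zero (by omega), show β - (k - 1) + k = β + 1 by omega])
    rw [Finset.sum_eq_single_of_mem (zv k) ((hlt _).mpr hzk) fun i hi hiz => ?_] at h
    · rw [brkt_single_of_ne (zero_ne_zv hk).symm, Fv_zv hk, map_neg, pderiv_zero_G hk,
        mul_neg, neg_neg, mul_one] at h
      exact eq_zero_of_ip_self_eq_zero h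
    · by_cases hi0 : i = 0
      · rw [hi0, hP_zero, ip_zero_right]
      · rw [brkt_single_of_ne hi0, Fv_of_ne hi0 hiz]
        simp [ip_zero_left]
  intro m hm
  by_cases hm0 : m = 0
  · rw [hm0, hP_zero]
  by_cases hmz : m = zv k
  · rw [hmz, hP_zv]
  have hdeg : β - (k - 1) + w k m + (k - 1) = β + w k m := by omega
  refine eq_zero_of_ip_derivation_eq_zero (δ := β - (k - 1) + w k m) hk
    (by rw [hdeg]; exact hP m hm) (fun s hs => ?_) fun q hq => ?_
  · rw [← coeff_aeval_erase (ev k) hs, hP0 m, coeff_zero]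
  · have h := hsingle m q hq
    rw [Finset.sum_eq_single_of_mem m ((hlt m).mpr hm) fun i hi him => ?_] at h
    · rwa [brkt_single_self, Fv_of_ne hm0 hmz, map_zero, mul_zero, sub_zero, ← hdeg] at h
    · by_cases hi0 : i = 0
      · rw [hi0, hP_zero, ip_zero_right]
      by_cases hiz : i = zv k
      · rw [hiz, hP_zv, ip_zero_right]
      rw [brkt_single_of_ne him, Fv_of_ne hi0 hiz]
      simp [ip_zero_left]
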